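/- Let X_1,…,X_K be mutually independent finitely-valued random variables and let (X_1,…,X_K,Y,Z) be jointly distributed. Let 𝒦₀ ⊊ 𝒦′ ⊆ 𝒦, write 𝒦̄′ = 𝒦∖𝒦′, 𝒦″ = 𝒦′∖𝒦₀ and 𝒦̄″ = 𝒦̄′ ∪ 𝒦₀. Assume that I(X_{𝒦₀};Y|X_{𝒦∖𝒦₀}) − I(X_{𝒦₀};Z|X_{𝒦̄′}) ≤ 0, and that for every nonempty V ⊆ 𝒦″, I(X_{𝒦₀∪V};Y|X_{𝒦∖(𝒦₀∪V)}) − I(X_{𝒦₀∪V};Z|X_{𝒦̄′}) > 0. Then for every nonempty V ⊆ 𝒦″, I(X_V;Y|X_{𝒦∖V}) − I(X_V;Z|X_{𝒦̄″}) > 0. -/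

import Mathlib

open scoped Classical

noncomputable section

/-- Probability that random variable `X` takes value `x`, under pmf `p` on a finite sample space. -/
def probOf {Ω α : Type} [Fintype Ω] (p : Ω → ℝ) (X : Ω → α) (x : α) : ℝ :=
  ∑ ω, if X ω = x then p ω else 0

/-- Shannon entropy of a finitely-valued random variable. -/
def Hent {Ω α : Type} [Fintype Ω] [Fintype α] (p : Ω → ℝ) (X : Ω → α) : ℝ :=
  -∑ x, probOf p X x * Real.log (probOf p X x)

/-- Conditional entropy `H(X | C)`. -/
def condHent {Ω α γ : Type} [Fintype Ω] [Fintype α] [Fintype γ]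
    (p : Ω → ℝ) (X : Ω → α) (C : Ω → γ) : ℝ :=
  Hent p (fun ω => (X ω, C ω)) - Hent p C

/-- Conditional mutual information `I(A;B | C)`. -/
def IcondMut {Ω α β γ : Type} [Fintype Ω] [Fintype α] [Fintype β] [Fintype γ]
    (p : Ω → ℝ) (A : Ω → α) (B : Ω → β) (C : Ω → γ) : ℝ :=
  condHent p A C + condHent p B C - condHent p (fun ω => (A ω, B ω)) C

/-- Mutual information `I(A;B)`. -/
def Imut {Ω α β : Type} [Fintype Ω] [Fintype α] [Fintype β]
    (p : Ω → ℝ) (A : Ω → α) (B : Ω → β) : ℝ :=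
  Hent p A + Hent p B - Hent p (fun ω => (A ω, B ω))

/-- `p` is a probability mass function. -/
def IsPMF {Ω : Type} [Fintype Ω] (p : Ω → ℝ) : Prop :=
  (∀ ω, 0 ≤ p ω) ∧ ∑ ω, p ω = 1

/-- The tuple `X_S = (X_k)_{k ∈ S}` as a random variable. -/
def tup {Ω ι : Type} {𝒳 : ι → Type} (X : ∀ k, Ω → 𝒳 k) (S : Finset ι) :
    Ω → ∀ k : S, 𝒳 k.1 :=
  fun ω k => X k.1 ω

/-- The random variables `X_1, …, X_K` are mutually independent. -/
def MutIndep {Ω ι : Type} [Fintype Ω] [Fintype ι] {𝒳 : ι → Type} [∀ k, Fintype (𝒳 k)]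
    (p : Ω → ℝ) (X : ∀ k, Ω → 𝒳 k) : Prop :=
  ∀ x : ∀ k, 𝒳 k, probOf p (fun ω k => X k ω) x = ∏ k, probOf p (X k) (x k)

section Entropy

variable {Ω α β γ : Type} [Fintype Ω] {p : Ω → ℝ}

lemma probOf_nonneg (hp : ∀ ω, 0 ≤ p ω) (A : Ω → α) (a : α) : 0 ≤ probOf p A a :=
  Finset.sum_nonneg fun ω _ => by split_ifs <;> simp [hp]

lemma probOf_self_pos (hp : ∀ ω, 0 ≤ p ω) (A : Ω → α) {ω : Ω} (hω : 0 < p ω) :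
    0 < probOf p A (A ω) := by
  refine Finset.sum_pos' (fun ω' _ => ?_) ⟨ω, Finset.mem_univ _, by simpa using hω⟩
  split_ifs <;> simp [hp]

variable [Fintype α]

/-- The law of the unconscious statistician. -/
lemma sum_probOf_mul (A : Ω → α) (f : α → ℝ) :
    ∑ a, probOf p A a * f a = ∑ ω, p ω * f (A ω) := by
  simp only [probOf, Finset.sum_mul]
  rw [Finset.sum_comm]
  simp [ite_mul]

lemma Hent_eq_sum (A : Ω → α) :
    Hent p A = -∑ ω, p ω * Real.log (probOf p A (A ω)) := by
  rw [Hent, sum_probOf_mul A fun a => Real.log (probOf p A a)]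

lemma sum_probOf (A : Ω → α) : ∑ a, probOf p A a = ∑ ω, p ω := by
  simpa using sum_probOf_mul (p := p) A fun _ => 1

lemma sum_probOf_prodMk (A : Ω → α) (C : Ω → γ) (c : γ) :
    ∑ a, probOf p (fun ω => (A ω, C ω)) (a, c) = probOf p C c := by
  simp only [probOf]
  rw [Finset.sum_comm]
  simp [Prod.ext_iff, ite_and]

variable [Fintype β]

/-- Entropy depends only on the partition of the sample space induced by the random variable. -/
lemma Hent_congr {A : Ω → α} {B : Ω → β} (h : ∀ ω ω', A ω = A ω' ↔ B ω = B ω') :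
    Hent p A = Hent p B := by
  simp only [Hent_eq_sum, probOf, h]

variable [Fintype γ]

/-- Strong subadditivity of entropy. -/
lemma Hent_submodular (hp : IsPMF p) (A : Ω → α) (B : Ω → β) (C : Ω → γ) :
    Hent p (fun ω => (A ω, B ω, C ω)) + Hent p C ≤
      Hent p (fun ω => (A ω, C ω)) + Hent p (fun ω => (B ω, C ω)) := by
  obtain ⟨hp0, hp1⟩ := hp
  set q := probOf p (fun ω => (A ω, B ω, C ω)) with hq
  set r := probOf p (fun ω => (A ω, C ω)) with hr
  set s := probOf p (fun ω => (B ω, C ω)) with hs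
  set t := probOf p C with ht
  have hr0 : ∀ x, 0 ≤ r x := probOf_nonneg hp0 _
  have hs0 : ∀ x, 0 ≤ s x := probOf_nonneg hp0 _
  have ht0 : ∀ x, 0 ≤ t x := probOf_nonneg hp0 _
  let f : α × β × γ → ℝ := fun x => r (x.1, x.2.2) * s x.2 / (q x * t x.2.2)
  have hf : ∑ ω, p ω * f (A ω, B ω, C ω) ≤ 1 := by
    rw [← sum_probOf_mul (p := p) (fun ω => (A ω, B ω, C ω)) f]
    calc ∑ x, q x * f x ≤ ∑ x : α × β × γ, r (x.1, x.2.2) * s x.2 / t x.2.2 := by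
          refine Finset.sum_le_sum fun x _ => ?_
          by_cases hx : q x = 0
          · rw [hx, zero_mul]
            exact div_nonneg (mul_nonneg (hr0 _) (hs0 _)) (ht0 _)
          · apply le_of_eq
            rw [mul_div_assoc', mul_div_mul_left _ _ hx]
      _ = ∑ c, (∑ a, r (a, c)) * (∑ b, s (b, c)) / t c := by
          simp only [Fintype.sum_prod_type, Finset.sum_mul_sum, Finset.sum_div]
          rw [Finset.sum_comm' (t' := Finset.univ) (s' := fun _ => Finset.univ) (by simp)]
          simp_rw [Finset.sum_comm (s := (Finset.univ : Finset α)) (t := (Finset.univ : Finset γ))]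
          rw [Finset.sum_comm]
          refine Finset.sum_congr rfl fun c _ => Finset.sum_comm
      _ = ∑ c, t c := by
          refine Finset.sum_congr rfl fun c _ => ?_
          rw [hr, hs, sum_probOf_prodMk, sum_probOf_prodMk, mul_self_div_self]
      _ = 1 := by rw [ht, sum_probOf, hp1]
  have key : ∀ ω, p ω * (Real.log (r (A ω, C ω)) + Real.log (s (B ω, C ω)) -
      Real.log (q (A ω, B ω, C ω)) - Real.log (t (C ω))) ≤
        p ω * f (A ω, B ω, C ω) - p ω := by
    intro ω
    rcases (hp0 ω).eq_or_lt with h0 | hω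
    · simp [← h0]
    have hq' : 0 < q (A ω, B ω, C ω) := probOf_self_pos hp0 (fun ω => (A ω, B ω, C ω)) hω
    have hr' : 0 < r (A ω, C ω) := probOf_self_pos hp0 (fun ω => (A ω, C ω)) hω
    have hs' : 0 < s (B ω, C ω) := probOf_self_pos hp0 (fun ω => (B ω, C ω)) hω
    have ht' : 0 < t (C ω) := probOf_self_pos hp0 C hω
    have hlog := Real.log_le_sub_one_of_pos (div_pos (mul_pos hr' hs') (mul_pos hq' ht'))
    rw [Real.log_div (by positivity) (by positivity), Real.log_mul hr'.ne' hs'.ne',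
      Real.log_mul hq'.ne' ht'.ne'] at hlog
    have := mul_le_mul_of_nonneg_left hlog hω.le
    simp only [f]
    linarith
  have hsum := Finset.sum_le_sum fun ω (_ : ω ∈ Finset.univ) => key ω
  simp only [mul_add, mul_sub, Finset.sum_add_distrib, Finset.sum_sub_distrib, hp1] at hsum
  simp only [Hent_eq_sum]
  linarith

end Entropy

section Tuples

variable {Ω ι : Type} {𝒳 : ι → Type} {X : ∀ k, Ω → 𝒳 k}

lemma tup_eq_iff {S : Finset ι} {ω ω' : Ω} :
    tup X S ω = tup X S ω' ↔ ∀ k ∈ S, X k ω = X k ω' := by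
  simp [tup, funext_iff]

variable [Fintype Ω] [DecidableEq ι] [∀ k, Fintype (𝒳 k)] {𝒴 : Type} [Fintype 𝒴] {p : Ω → ℝ}

lemma Hent_tup_union_le (hp : IsPMF p) (S T : Finset ι) :
    Hent p (tup X (S ∪ T)) ≤ Hent p (tup X S) + Hent p (tup X T) := by
  have h := Hent_submodular hp (tup X S) (tup X T) (fun _ => ())
  have hunit : Hent p (fun _ => ()) = 0 := by simp [Hent, probOf, hp.2]
  have h₁ : Hent p (fun ω => (tup X S ω, tup X T ω, ())) = Hent p (tup X (S ∪ T)) :=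
    Hent_congr fun ω ω' => by simp only [Prod.mk.injEq, tup_eq_iff]; grind
  have h₂ : Hent p (fun ω => (tup X S ω, ())) = Hent p (tup X S) :=
    Hent_congr fun ω ω' => by simp
  have h₃ : Hent p (fun ω => (tup X T ω, ())) = Hent p (tup X T) :=
    Hent_congr fun ω ω' => by simp
  linarith

lemma Hent_tup_le_sum (hp : IsPMF p) (S : Finset ι) :
    Hent p (tup X S) ≤ ∑ k ∈ S, Hent p (X k) := by
  induction S using Finset.induction_on with
  | empty =>
    have : Hent p (tup X ∅) = Hent p (fun _ => ()) :=
      Hent_congr fun ω ω' => by simp [tup_eq_iff]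
    rw [this]
    simp [Hent, probOf, hp.2]
  | insert k S hk ih =>
    have h := Hent_tup_union_le (X := X) hp {k} S
    have hsingle : Hent p (tup X {k}) = Hent p (X k) :=
      Hent_congr fun ω ω' => by simp [tup_eq_iff]
    rw [← Finset.insert_eq] at h
    rw [Finset.sum_insert hk]
    linarith

lemma Hent_tup_univ [Fintype ι] (hp : IsPMF p) (hind : MutIndep p X) :
    Hent p (tup X Finset.univ) = ∑ k, Hent p (X k) := by
  have h : Hent p (tup X Finset.univ) = Hent p (fun ω k => X k ω) :=
    Hent_congr fun ω ω' => by rw [tup_eq_iff]; simp [funext_iff]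
  rw [h]
  simp only [Hent_eq_sum, Finset.sum_neg_distrib]
  rw [Finset.sum_comm]
  refine congrArg _ (Finset.sum_congr rfl fun ω _ => ?_)
  rw [← Finset.mul_sum, hind]
  rcases (hp.1 ω).eq_or_lt with h0 | hω
  · simp [← h0]
  · rw [Real.log_prod fun k _ => (probOf_self_pos hp.1 (X k) hω).ne']

lemma Hent_tup_eq_sum [Fintype ι] (hp : IsPMF p) (hind : MutIndep p X) (S : Finset ι) :
    Hent p (tup X S) = ∑ k ∈ S, Hent p (X k) := by
  have h₁ := Hent_tup_le_sum (X := X) hp S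
  have h₂ := Hent_tup_le_sum (X := X) hp Sᶜ
  have h₃ := Hent_tup_union_le (X := X) hp S Sᶜ
  rw [Finset.union_compl, Hent_tup_univ hp hind, ← Finset.sum_add_sum_compl S] at h₃
  linarith

lemma IcondMut_tup (S T : Finset ι) (Y : Ω → 𝒴) :
    IcondMut p (tup X S) Y (tup X T) =
      Hent p (tup X (S ∪ T)) + Hent p (fun ω => (tup X T ω, Y ω)) - Hent p (tup X T) -
        Hent p (fun ω => (tup X (S ∪ T) ω, Y ω)) := by
  have h₁ : Hent p (fun ω => (tup X S ω, tup X T ω)) = Hent p (tup X (S ∪ T)) :=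
    Hent_congr fun ω ω' => by simp only [Prod.mk.injEq, tup_eq_iff]; grind
  have h₂ : Hent p (fun ω => (Y ω, tup X T ω)) = Hent p (fun ω => (tup X T ω, Y ω)) :=
    Hent_congr fun ω ω' => by simp only [Prod.mk.injEq]; tauto
  have h₃ : Hent p (fun ω => ((tup X S ω, Y ω), tup X T ω)) =
      Hent p (fun ω => (tup X (S ∪ T) ω, Y ω)) :=
    Hent_congr fun ω ω' => by simp only [Prod.mk.injEq, tup_eq_iff]; grind
  rw [IcondMut, condHent, condHent, condHent, h₁, h₂, h₃]
  ring

/-- The chain rule for mutual information. -/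
lemma IcondMut_tup_union (S V T : Finset ι) (Y : Ω → 𝒴) :
    IcondMut p (tup X (S ∪ V)) Y (tup X T) =
      IcondMut p (tup X S) Y (tup X T) + IcondMut p (tup X V) Y (tup X (T ∪ S)) := by
  have h : V ∪ (T ∪ S) = S ∪ V ∪ T := by grind
  rw [IcondMut_tup, IcondMut_tup, IcondMut_tup, h, Finset.union_comm T S]
  ring

/-- Conditioning on further independent inputs does not decrease mutual information. -/
lemma IcondMut_tup_le_of_indep [Fintype ι] (hp : IsPMF p) (hind : MutIndep p X)
    {S V T : Finset ι} (hSV : Disjoint S V) (Y : Ω → 𝒴) :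
    IcondMut p (tup X S) Y (tup X T) ≤ IcondMut p (tup X S) Y (tup X (T ∪ V)) := by
  have h := Hent_submodular hp (tup X S) (tup X V) (fun ω => (tup X T ω, Y ω))
  have h₁ : Hent p (fun ω => (tup X S ω, tup X V ω, tup X T ω, Y ω)) =
      Hent p (fun ω => (tup X (S ∪ (T ∪ V)) ω, Y ω)) :=
    Hent_congr fun ω ω' => by simp only [Prod.mk.injEq, tup_eq_iff]; grind
  have h₂ : Hent p (fun ω => (tup X S ω, tup X T ω, Y ω)) =
      Hent p (fun ω => (tup X (S ∪ T) ω, Y ω)) :=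
    Hent_congr fun ω ω' => by simp only [Prod.mk.injEq, tup_eq_iff]; grind
  have h₃ : Hent p (fun ω => (tup X V ω, tup X T ω, Y ω)) =
      Hent p (fun ω => (tup X (T ∪ V) ω, Y ω)) :=
    Hent_congr fun ω ω' => by simp only [Prod.mk.injEq, tup_eq_iff]; grind
  have hmod := Finset.sum_union_inter (s₁ := S ∪ T) (s₂ := T ∪ V) (f := fun k => Hent p (X k))
  have hunion : S ∪ T ∪ (T ∪ V) = S ∪ (T ∪ V) := by grind
  have hinter : (S ∪ T) ∩ (T ∪ V) = T := by
    rw [Finset.disjoint_left] at hSV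
    grind
  simp only [hunion, hinter, ← Hent_tup_eq_sum hp hind] at hmod
  simp only [IcondMut_tup]
  linarith

end Tuples

theorem stmt9 {K : ℕ} (hK : 1 ≤ K) {Ω : Type} [Fintype Ω]
    {𝒳 : Fin K → Type} [∀ k, Fintype (𝒳 k)] {𝒴 𝒵 : Type} [Fintype 𝒴] [Fintype 𝒵]
    (p : Ω → ℝ) (hp : IsPMF p)
    (X : ∀ k, Ω → 𝒳 k) (Y : Ω → 𝒴) (Z : Ω → 𝒵) (hind : MutIndep p X)
    (K₀ K' : Finset (Fin K)) (hK₀ : K₀ ⊂ K')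
    (h1 : IcondMut p (tup X K₀) Y (tup X (Finset.univ \ K₀)) -
            IcondMut p (tup X K₀) Z (tup X (Finset.univ \ K')) ≤ 0)
    (h2 : ∀ V ⊆ K' \ K₀, V.Nonempty →
      0 < IcondMut p (tup X (K₀ ∪ V)) Y (tup X (Finset.univ \ (K₀ ∪ V))) -
            IcondMut p (tup X (K₀ ∪ V)) Z (tup X (Finset.univ \ K'))) :
    ∀ V ⊆ K' \ K₀, V.Nonempty →
      0 < IcondMut p (tup X V) Y (tup X (Finset.univ \ V)) -
            IcondMut p (tup X V) Z (tup X ((Finset.univ \ K') ∪ K₀)) := by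
  intro V hV hne
  have hdisj : Disjoint K₀ V := Finset.disjoint_of_subset_right hV Finset.disjoint_sdiff
  have hset₁ : (Finset.univ \ (K₀ ∪ V)) ∪ V = Finset.univ \ K₀ := by
    rw [Finset.disjoint_left] at hdisj
    grind
  have hset₂ : (Finset.univ \ (K₀ ∪ V)) ∪ K₀ = Finset.univ \ V := by
    rw [Finset.disjoint_left] at hdisj
    grind
  have hpos := h2 V hV hne
  have hle := IcondMut_tup_le_of_indep hp hind (T := Finset.univ \ (K₀ ∪ V)) hdisj Y
  rw [IcondMut_tup_union, IcondMut_tup_union, hset₂] at hpos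
  rw [hset₁] at hle
  linarith
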